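/- arXiv:2303.08197 — 2 statements merged into one kernel-verified Lean document; each statement's English description precedes it below -/
import Mathlib

section
/- Proposition 3.8 (optimal q): Fix a positive integer s and a real D > 0, and define f(q) = ((qs)!)^{1/(2q)} · D^{1/q} for positive integers q (f is the q-dependent factor of the signal strength δ(q) ≍ binom(r,s)√a ((qs)!)^{1/(2q)} (√N R/d)^{1/q} n^{s/2} with D = √N R / d). Then: (i) if D ≤ 1 (i.e., d ≥ √N R), then f(2) ≤ f(q) for every integer q ≥ 2, so the minimizer of δ(q) over even positive integers is q = 2; (ii) if D > 1 (i.e., d < √N R), let g(q) = (P^{(q+1)s}_s)^q / (qs)! where P^m_s = m!/(m−s)!; then the minimizer of f over integers q ≥ 2 is q₀ := min{q ≥ 2 : g(q) ≥ D²}, in the sense that f(q+1) < f(q) for all 2 ≤ q < q₀ and f(q+1) > f(q) for all q ≥ q₀ with g(q) > D² (f(q+1) = f(q) when g(q) = D²); moreover, q₀ is nondecreasing as a function of D: if 1 < D ≤ D′ then q₀(D) ≤ q₀(D′). -/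
/-- `f(q) = ((qs)!)^{1/(2q)} · D^{1/q}`: the `q`-dependent factor of the signal strength
`δ(q) ≍ binom(r,s)·√a·((qs)!)^{1/(2q)}·(√N R/d)^{1/q}·n^{s/2}` with `D = √N·R/d`. -/
noncomputable def fSig (s : ℕ) (D : ℝ) (q : ℕ) : ℝ :=
  (((q * s).factorial : ℝ)) ^ ((1 : ℝ) / (2 * q)) * D ^ ((1 : ℝ) / q)

/-- `g(q) = (P^{(q+1)s}_s)^q / (qs)!`, where `P^m_s = m!/(m−s)!` is the falling factorial. -/
noncomputable def gSig (s : ℕ) (q : ℕ) : ℝ :=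
  ((((q + 1) * s).descFactorial s : ℝ)) ^ q / ((q * s).factorial : ℝ)

/-- `q₀(D) = min{q ≥ 2 : g(q) ≥ D²}`. -/
noncomputable def qOpt (s : ℕ) (D : ℝ) : ℕ :=
  sInf {q : ℕ | 2 ≤ q ∧ D ^ 2 ≤ gSig s q}

theorem fSig_pos' (s : ℕ) (D : ℝ) (hD : 0 < D) (q : ℕ) : 0 < fSig s D q := by
  unfold fSig
  have : (0 : ℝ) < ((q * s).factorial : ℝ) := by exact_mod_cast Nat.factorial_pos _
  positivity

theorem fSig_pow' (s : ℕ) (D : ℝ) (hD : 0 < D) (q : ℕ) (hq : 1 ≤ q) (k : ℕ) :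
    fSig s D q ^ (2 * q * k) = ((q * s).factorial : ℝ) ^ k * D ^ (2 * k) := by
  have hA : (0 : ℝ) < ((q * s).factorial : ℝ) := by exact_mod_cast Nat.factorial_pos _
  have hq0 : (q : ℝ) ≠ 0 := by positivity
  unfold fSig
  rw [mul_pow, ← Real.rpow_natCast, ← Real.rpow_natCast, ← Real.rpow_mul hA.le,
    ← Real.rpow_mul hD.le]
  have e1 : (1 : ℝ) / (2 * q) * ((2 * q * k : ℕ) : ℝ) = (k : ℕ) := by
    push_cast; field_simp
  have e2 : (1 : ℝ) / q * ((2 * q * k : ℕ) : ℝ) = ((2 * k : ℕ) : ℝ) := by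
    push_cast; field_simp
  rw [e1, e2, Real.rpow_natCast, Real.rpow_natCast]

theorem fSig_key' (s : ℕ) (D : ℝ) (hD : 0 < D) (q : ℕ) (hq : 1 ≤ q) :
    fSig s D (q + 1) ^ (2 * q * (q + 1)) * D ^ 2 =
      fSig s D q ^ (2 * q * (q + 1)) * gSig s q := by
  have hA : (0 : ℝ) < ((q * s).factorial : ℝ) := by exact_mod_cast Nat.factorial_pos _
  have h1 := fSig_pow' s D hD (q + 1) (by omega) q
  rw [show 2 * (q + 1) * q = 2 * q * (q + 1) by ring] at h1
  rw [h1, fSig_pow' s D hD q hq (q + 1)]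
  have h2 : ((((q + 1) * s).factorial : ℕ) : ℝ) =
      ((q * s).factorial : ℝ) * (((q + 1) * s).descFactorial s : ℝ) := by
    have := Nat.factorial_mul_descFactorial (n := (q + 1) * s) (k := s)
      (Nat.le_mul_of_pos_left s (by omega))
    rw [show (q + 1) * s - s = q * s by rw [add_mul, one_mul, Nat.add_sub_cancel]] at this
    exact_mod_cast this.symm
  rw [h2]
  unfold gSig
  field_simp
  ring

theorem gSig_ge' (s : ℕ) (hs : 0 < s) (q : ℕ) : (q : ℝ) + 1 ≤ gSig s q := by
  have hA : (0 : ℝ) < ((q * s).factorial : ℝ) := by exact_mod_cast Nat.factorial_pos _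
  unfold gSig
  rw [le_div_iff₀ hA]
  have h1 : (q * s + 1) ^ s ≤ ((q + 1) * s).descFactorial s := by
    have := Nat.pow_sub_le_descFactorial ((q + 1) * s) s
    rwa [show (q + 1) * s + 1 - s = q * s + 1 by rw [add_mul, one_mul]; omega] at this
  have h2 : (q * s + 1).factorial ≤ (q * s + 1) ^ (q * s) := by
    have h3 := Nat.descFactorial_le_pow (q * s + 1) (q * s)
    have h4 := Nat.factorial_mul_descFactorial (n := q * s + 1) (k := q * s) (by omega)
    simp only [Nat.add_sub_cancel_left, Nat.factorial_one, one_mul] at h4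
    omega
  have h5 : (q + 1) * (q * s).factorial ≤ (((q + 1) * s).descFactorial s) ^ q := by
    calc (q + 1) * (q * s).factorial ≤ (q * s + 1) * (q * s).factorial := by
          gcongr; exact Nat.le_mul_of_pos_right q hs
      _ = (q * s + 1).factorial := (Nat.factorial_succ _).symm
      _ ≤ (q * s + 1) ^ (q * s) := h2
      _ = ((q * s + 1) ^ s) ^ q := by rw [← pow_mul, mul_comm]
      _ ≤ _ := Nat.pow_le_pow_left h1 q
  exact_mod_cast h5

theorem fSig_step_le' (s : ℕ) (D : ℝ) (hD : 0 < D) (q : ℕ) (hq : 1 ≤ q)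
    (h : D ^ 2 ≤ gSig s q) : fSig s D q ≤ fSig s D (q + 1) := by
  have key := fSig_key' s D hD q hq
  have hp := pow_pos (fSig_pos' s D hD q) (2 * q * (q + 1))
  by_contra hlt
  have := pow_lt_pow_left₀ (not_le.mp hlt) (fSig_pos' s D hD (q + 1)).le
    (show 2 * q * (q + 1) ≠ 0 by positivity)
  have h2 := mul_lt_mul_of_pos_right this (pow_pos hD 2)
  have h3 := mul_le_mul_of_nonneg_left h hp.le
  linarith

theorem fSig_step_ge' (s : ℕ) (D : ℝ) (hD : 0 < D) (q : ℕ) (hq : 1 ≤ q)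
    (h : gSig s q ≤ D ^ 2) : fSig s D (q + 1) ≤ fSig s D q := by
  have key := fSig_key' s D hD q hq
  have hp := pow_pos (fSig_pos' s D hD q) (2 * q * (q + 1))
  by_contra hlt
  have := pow_lt_pow_left₀ (not_le.mp hlt) (fSig_pos' s D hD q).le
    (show 2 * q * (q + 1) ≠ 0 by positivity)
  have h2 := mul_lt_mul_of_pos_right this (pow_pos hD 2)
  have h3 := mul_le_mul_of_nonneg_left h hp.le
  linarith

theorem fSig_step_ne' (s : ℕ) (D : ℝ) (hD : 0 < D) (q : ℕ) (hq : 1 ≤ q)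
    (h : fSig s D (q + 1) = fSig s D q) : gSig s q = D ^ 2 := by
  have key := fSig_key' s D hD q hq
  have hp := pow_pos (fSig_pos' s D hD q) (2 * q * (q + 1))
  rw [h] at key
  exact (mul_left_cancel₀ hp.ne' key).symm

/-- **Proposition 3.8 (optimal q).** Fix a positive integer `s` and a real `D > 0` and let
`f(q) = ((qs)!)^{1/(2q)} D^{1/q}`. (i) If `D ≤ 1` then `f(2) ≤ f(q)` for every integer
`q ≥ 2`, so the minimizer of `δ(q)` over even positive integers is `q = 2`. (ii) If `D > 1`,
with `g(q) = (P^{(q+1)s}_s)^q/(qs)!` and `q₀ = min{q ≥ 2 : g(q) ≥ D²}`, `f` is strictly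
decreasing before `q₀` (`f(q+1) < f(q)` for `2 ≤ q < q₀`), strictly increasing after
(`f(q) < f(q+1)` for `q ≥ q₀` with `g(q) > D²`, with equality `f(q+1) = f(q)` when
`g(q) = D²`); moreover `q₀` is nondecreasing in `D`. -/
theorem optimal_q (s : ℕ) (hs : 0 < s) (D : ℝ) (hD : 0 < D) :
    (D ≤ 1 → ∀ q : ℕ, 2 ≤ q → fSig s D 2 ≤ fSig s D q) ∧
    (1 < D →
      ((∀ q : ℕ, 2 ≤ q → q < qOpt s D → fSig s D (q + 1) < fSig s D q) ∧
       (∀ q : ℕ, qOpt s D ≤ q → D ^ 2 < gSig s q → fSig s D q < fSig s D (q + 1)) ∧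
       (∀ q : ℕ, 2 ≤ q → gSig s q = D ^ 2 → fSig s D (q + 1) = fSig s D q))) ∧
    (∀ D' : ℝ, 1 < D → D ≤ D' → qOpt s D ≤ qOpt s D') := by
  refine ⟨?_, ?_, ?_⟩
  · intro h1 q hq
    induction q, hq using Nat.le_induction with
    | base => exact le_rfl
    | succ n hn ih =>
      refine ih.trans (fSig_step_le' s D hD n (by omega) ?_)
      have := gSig_ge' s hs n
      have hn0 : (0 : ℝ) ≤ n := Nat.cast_nonneg n
      nlinarith
  · intro h1
    refine ⟨?_, ?_, ?_⟩
    · intro q hq hlt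
      have hm := Nat.notMem_of_lt_sInf hlt
      have hg : gSig s q < D ^ 2 := by
        by_contra hc
        exact hm ⟨hq, not_lt.mp hc⟩
      exact lt_of_le_of_ne (fSig_step_ge' s D hD q (by omega) hg.le)
        (fun e => hg.ne (fSig_step_ne' s D hD q (by omega) e))
    · intro q _ hg
      have hq : 1 ≤ q := by
        rcases Nat.eq_zero_or_pos q with h0 | h0
        · subst h0
          simp [gSig] at hg
          linarith [le_abs_self D]
        · exact h0
      exact lt_of_le_of_ne (fSig_step_le' s D hD q hq hg.le)
        (fun e => hg.ne' (fSig_step_ne' s D hD q hq e.symm))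
    · intro q hq hg
      exact le_antisymm (fSig_step_ge' s D hD q (by omega) hg.le)
        (fSig_step_le' s D hD q (by omega) hg.ge)
  · intro D' h1 hle
    have hne : {q : ℕ | 2 ≤ q ∧ D' ^ 2 ≤ gSig s q}.Nonempty := by
      obtain ⟨n, hn⟩ := exists_nat_ge (D' ^ 2)
      refine ⟨n + 2, by omega, ?_⟩
      have := gSig_ge' s hs (n + 2)
      push_cast at this
      linarith
    have hm := Nat.sInf_mem hne
    refine Nat.sInf_le ⟨hm.1, le_trans ?_ hm.2⟩
    gcongr
end

section
/- Factorial power inequality: For all positive integers q and s, (((q+1)·s)!)^q ≥ ((q·s)!)^{q+1}. Equivalently, the sequence q ↦ ((qs)!)^{1/(2q)} is nondecreasing in q, and equivalently g(q) = (P^{(q+1)s}_s)^q / (qs)! ≥ 1 for all positive integers q, where P^m_s = m!/(m−s)!. -/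
/-- **Factorial power inequality.** For all positive integers `q` and `s`,
`(((q+1)·s)!)^q ≥ ((q·s)!)^(q+1)`; equivalently, `q ↦ ((qs)!)^(1/(2q))` is nondecreasing,
and equivalently `g(q) = (P^{(q+1)s}_s)^q / (qs)! ≥ 1`, where `P^m_s = m!/(m−s)!` is the
falling (descending) factorial. -/
theorem factorial_power_inequality (q s : ℕ) (hq : 0 < q) (hs : 0 < s) :
    (((q * s).factorial : ℕ) ^ (q + 1) ≤ (((q + 1) * s).factorial) ^ q) ∧
    (((q * s).factorial : ℝ) ^ ((1 : ℝ) / (2 * q)) ≤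
      ((((q + 1) * s).factorial : ℝ)) ^ ((1 : ℝ) / (2 * (q + 1)))) ∧
    (1 ≤ ((((q + 1) * s).descFactorial s : ℝ)) ^ q / ((q * s).factorial : ℝ)) := by
  have hsub : (q + 1) * s - s = q * s := by
    rw [Nat.add_mul, one_mul, Nat.add_sub_cancel]
  have hle : s ≤ (q + 1) * s := Nat.le_mul_of_pos_left s (Nat.succ_pos q)
  have hfac : (q * s).factorial * ((q + 1) * s).descFactorial s = ((q + 1) * s).factorial := by
    have h := Nat.factorial_mul_descFactorial hle
    rwa [hsub] at h
  have hD : (q * s) ^ s ≤ ((q + 1) * s).descFactorial s := by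
    refine le_trans (Nat.pow_le_pow_left ?_ s) (Nat.pow_sub_le_descFactorial _ s)
    have : (q + 1) * s = q * s + s := by ring
    omega
  have key : (q * s).factorial ≤ (((q + 1) * s).descFactorial s) ^ q := by
    calc (q * s).factorial ≤ (q * s) ^ (q * s) := Nat.factorial_le_pow _
      _ = ((q * s) ^ s) ^ q := by rw [← pow_mul, mul_comm s q]
      _ ≤ _ := Nat.pow_le_pow_left hD q
  have h1 : ((q * s).factorial : ℕ) ^ (q + 1) ≤ (((q + 1) * s).factorial) ^ q := by
    rw [← hfac, mul_pow, pow_succ]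
    exact Nat.mul_le_mul_left _ key
  refine ⟨h1, ?_, ?_⟩
  · have hq' : (0 : ℝ) < q := by exact_mod_cast hq
    have h1' : ((q * s).factorial : ℝ) ^ (q + 1) ≤ (((q + 1) * s).factorial : ℝ) ^ q := by
      exact_mod_cast h1
    have h2 := Real.rpow_le_rpow (by positivity) h1'
      (show (0 : ℝ) ≤ 1 / (2 * q * (q + 1)) by positivity)
    rw [← Real.rpow_natCast_mul (by positivity), ← Real.rpow_natCast_mul (by positivity)] at h2
    convert h2 using 2
    · push_cast
      field_simp
    · field_simp
  · rw [one_le_div (by positivity)]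
    exact_mod_cast key
end
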